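/- arXiv:0810.2813 — 2 statements merged into one kernel-verified Lean document; each statement's English description precedes it below -/
import Mathlib

section
/- Preservation of absolute continuity (Corollary 3.2): Suppose the rate functions are bounded and measurable and Assumption (A3) holds, and let μ be a σ-finite Borel measure on W such that for every ρ ∈ P(W) with ρ ≪ μ, the finite measure ∫_W γ(w,ρ) a(w,ρ,·) ρ(dw) on W is absolutely continuous with respect to μ and the finite measure ∫_W ∫_W λ(w₁,w₂,ρ) b(w₁,w₂,ρ,·) ρ(dw₂) ρ(dw₁) on W×W is absolutely continuous with respect to μ⊗μ. If ν : [0,T] → P(W) is a weakly continuous solution of system (S) with ν₀ absolutely continuous with respect to μ, then ν_t is absolutely continuous with respect to μ for every t ∈ [0,T]. -/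
open MeasureTheory Set

noncomputable section

variable {W : Type*} [MeasurableSpace W] [TopologicalSpace W] [PolishSpace W]
  [BorelSpace W] [LocallyCompactSpace W]

/-- Total variation distance between two (finite) measures:
`‖μ₁ - μ₂‖_TV = sup {|∫ φ dμ₁ - ∫ φ dμ₂| : φ measurable, ‖φ‖_∞ ≤ 1}`. -/
noncomputable def tvDist {α : Type*} [MeasurableSpace α] (μ₁ μ₂ : Measure α) : ℝ :=
  ⨆ φ : {f : α → ℝ // Measurable f ∧ ∀ x, |f x| ≤ 1},
    |(∫ x, φ.1 x ∂μ₁) - ∫ x, φ.1 x ∂μ₂|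

/-- The finite measure `∫_W γ(w,ν) a(w,ν,·) ν(dw)` on `W`. -/
noncomputable def jumpMeasA (γf : W → ProbabilityMeasure W → ℝ)
    (a : W → ProbabilityMeasure W → ProbabilityMeasure W)
    (ν : ProbabilityMeasure W) : Measure W :=
  (ν : Measure W).bind fun w => ENNReal.ofReal (γf w ν) • (a w ν : Measure W)

/-- The finite measure `∫_W ∫_W λ(w₁,w₂,ν) b(w₁,w₂,ν,·) ν(dw₂) ν(dw₁)` on `W × W`. -/
noncomputable def jumpMeasB (lf : W → W → ProbabilityMeasure W → ℝ)
    (b : W → W → ProbabilityMeasure W → ProbabilityMeasure (W × W))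
    (ν : ProbabilityMeasure W) : Measure (W × W) :=
  (ν : Measure W).bind fun w₁ =>
    (ν : Measure W).bind fun w₂ =>
      ENNReal.ofReal (lf w₁ w₂ ν) • (b w₁ w₂ ν : Measure (W × W))

/-- Basic standing assumptions on the model data: the rate functions are nonnegative,
bounded (by `γbar`, `lbar`), measurable in the `W`-variables and continuous in `ν`, and the
transition kernels are measurable in the `W`-variables. -/
def RatesOK (γbar lbar : ℝ) (γf : W → ProbabilityMeasure W → ℝ)
    (lf : W → W → ProbabilityMeasure W → ℝ)
    (a : W → ProbabilityMeasure W → ProbabilityMeasure W)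
    (b : W → W → ProbabilityMeasure W → ProbabilityMeasure (W × W)) : Prop :=
  (∀ ν, Measurable fun w => γf w ν) ∧
  (∀ w ν, γf w ν ∈ Icc (0 : ℝ) γbar) ∧
  (∀ w, Continuous fun ν : ProbabilityMeasure W => γf w ν) ∧
  (∀ ν, Measurable fun p : W × W => lf p.1 p.2 ν) ∧
  (∀ w₁ w₂ ν, lf w₁ w₂ ν ∈ Icc (0 : ℝ) lbar) ∧
  (∀ w₁ w₂, Continuous fun ν : ProbabilityMeasure W => lf w₁ w₂ ν) ∧
  (∀ ν, Measurable fun w => (a w ν : Measure W)) ∧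
  (∀ ν, Measurable fun p : W × W => (b p.1 p.2 ν : Measure (W × W)))

/-- Assumption (A3): the maps `ν ↦ ∫ γ(w,ν) a(w,ν,·) ν(dw)` and
`ν ↦ ∫∫ λ(w₁,w₂,ν) b(w₁,w₂,ν,·) ν(dw₂) ν(dw₁)` are continuous for the topology of weak
convergence and Lipschitz with respect to the total variation norm. -/
def AssumptionA3 (γf : W → ProbabilityMeasure W → ℝ)
    (lf : W → W → ProbabilityMeasure W → ℝ)
    (a : W → ProbabilityMeasure W → ProbabilityMeasure W)
    (b : W → W → ProbabilityMeasure W → ProbabilityMeasure (W × W)) : Prop :=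
  (∀ φ : BoundedContinuousFunction W ℝ,
    Continuous fun ν : ProbabilityMeasure W => ∫ w, φ w ∂(jumpMeasA γf a ν)) ∧
  (∀ φ : BoundedContinuousFunction (W × W) ℝ,
    Continuous fun ν : ProbabilityMeasure W => ∫ p, φ p ∂(jumpMeasB lf b ν)) ∧
  (∃ Ca : ℝ, 0 < Ca ∧ ∀ ν₁ ν₂ : ProbabilityMeasure W,
    tvDist (jumpMeasA γf a ν₁) (jumpMeasA γf a ν₂) ≤ Ca * tvDist (ν₁ : Measure W) (ν₂ : Measure W)) ∧
  (∃ Cb : ℝ, 0 < Cb ∧ ∀ ν₁ ν₂ : ProbabilityMeasure W,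
    tvDist (jumpMeasB lf b ν₁) (jumpMeasB lf b ν₂) ≤ Cb * tvDist (ν₁ : Measure W) (ν₂ : Measure W))

/-- `ν : [0,T] → P(W)` solves the system (S): for every bounded measurable `φ` and `t ∈ [0,T]`,
`⟨ν_t,φ⟩ = ⟨ν₀,φ⟩ + ∫₀ᵗ ∫ γ(w,ν_s) ∫ (φ(w')-φ(w)) a(w,ν_s,dw') ν_s(dw) ds
  + ∫₀ᵗ ∫∫ λ(w₁,w₂,ν_s) ∫ (φ(w₁')+φ(w₂')-φ(w₁)-φ(w₂)) b(w₁,w₂,ν_s,dw₁'⊗dw₂') ν_s(dw₂) ν_s(dw₁) ds`. -/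
def SolvesS (T : ℝ) (γf : W → ProbabilityMeasure W → ℝ)
    (lf : W → W → ProbabilityMeasure W → ℝ)
    (a : W → ProbabilityMeasure W → ProbabilityMeasure W)
    (b : W → W → ProbabilityMeasure W → ProbabilityMeasure (W × W))
    (ν : ℝ → ProbabilityMeasure W) : Prop :=
  ∀ φ : W → ℝ, Measurable φ → (∃ M : ℝ, ∀ w, |φ w| ≤ M) →
    ∀ t ∈ Icc (0 : ℝ) T,
      ∫ w, φ w ∂(ν t : Measure W) =
        (∫ w, φ w ∂(ν 0 : Measure W))
        + (∫ s in (0 : ℝ)..t, ∫ w, γf w (ν s) *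
            ∫ w', (φ w' - φ w) ∂(a w (ν s) : Measure W) ∂(ν s : Measure W))
        + ∫ s in (0 : ℝ)..t, ∫ w₁, ∫ w₂, lf w₁ w₂ (ν s) *
            ∫ p : W × W, (φ p.1 + φ p.2 - φ w₁ - φ w₂) ∂(b w₁ w₂ (ν s) : Measure (W × W))
            ∂(ν s : Measure W) ∂(ν s : Measure W)


lemma aux_tv_bdd {α : Type*} [MeasurableSpace α] (m₁ m₂ : Measure α) [IsFiniteMeasure m₁]
    [IsFiniteMeasure m₂] :
    BddAbove (range fun φ : {f : α → ℝ // Measurable f ∧ ∀ x, |f x| ≤ 1} =>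
      |(∫ x, φ.1 x ∂m₁) - ∫ x, φ.1 x ∂m₂|) := by
  refine ⟨1 * m₁.real univ + 1 * m₂.real univ, ?_⟩
  rintro _ ⟨φ, rfl⟩
  have h1 := norm_integral_le_of_norm_le_const (μ := m₁) (f := φ.1) (C := 1)
    (Filter.Eventually.of_forall fun x => by simpa using φ.2.2 x)
  have h2 := norm_integral_le_of_norm_le_const (μ := m₂) (f := φ.1) (C := 1)
    (Filter.Eventually.of_forall fun x => by simpa using φ.2.2 x)
  rw [Real.norm_eq_abs] at h1 h2
  exact (abs_sub _ _).trans (add_le_add h1 h2)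

lemma aux_tv_set {α : Type*} [MeasurableSpace α] (m₁ m₂ : Measure α) [IsFiniteMeasure m₁]
    [IsFiniteMeasure m₂] (S : Set α) (hS : MeasurableSet S) (h : m₂ S = 0) :
    m₁.real S ≤ tvDist m₁ m₂ := by
  have := le_ciSup (aux_tv_bdd m₁ m₂) ⟨S.indicator 1, measurable_one.indicator hS, fun x => by
    by_cases hx : x ∈ S <;> simp [hx]⟩
  simp only [integral_indicator_one hS] at this
  have h2 : m₂.real S = 0 := by simp [Measure.real, h]
  rw [h2, sub_zero] at this
  exact (le_abs_self _).trans this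

lemma aux_approx (μ : Measure W) [SigmaFinite μ] (ν ν₀ : ProbabilityMeasure W)
    (h0 : (ν₀ : Measure W) ≪ μ) (δ : ℝ)
    (hδ : ∀ N, MeasurableSet N → μ N = 0 → (ν : Measure W).real N ≤ δ) :
    ∃ ρ : ProbabilityMeasure W, (ρ : Measure W) ≪ μ ∧
      tvDist (ν : Measure W) (ρ : Measure W) ≤ 2 * δ := by
  set σ := (ν : Measure W).singularPart μ with hσ
  set α := μ.withDensity ((ν : Measure W).rnDeriv μ) with hα
  have hdec : (ν : Measure W) = σ + α := (ν : Measure W).haveLebesgueDecomposition_add μ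
  have hαμ : α ≪ μ := withDensity_absolutelyContinuous _ _
  haveI : IsFiniteMeasure α := ⟨by
    have : α univ ≤ (ν : Measure W) univ := by rw [hdec]; simp
    exact this.trans_lt (measure_lt_top _ _)⟩
  haveI : IsFiniteMeasure σ := ⟨by
    have : σ univ ≤ (ν : Measure W) univ := by rw [hdec]; simp
    exact this.trans_lt (measure_lt_top _ _)⟩
  have hu : σ.real univ ≤ δ := by
    obtain ⟨E, hE, h1, h2⟩ := (ν : Measure W).mutuallySingular_singularPart μ
    refine le_trans ?_ (hδ Eᶜ hE.compl h2)
    have : σ univ ≤ (ν : Measure W) Eᶜ := by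
      calc σ univ ≤ σ E + σ Eᶜ := by rw [← union_compl_self E]; exact measure_union_le _ _
        _ = σ Eᶜ := by rw [hσ, h1, zero_add]
        _ ≤ _ := by rw [hdec]; simp
    exact ENNReal.toReal_mono (measure_ne_top _ _) this
  let r : Measure W := σ univ • (ν₀ : Measure W) + α
  have hr : IsProbabilityMeasure r := ⟨by
    have : (ν : Measure W) univ = 1 := measure_univ
    rw [hdec] at this
    simpa [r] using this⟩
  refine ⟨⟨r, hr⟩, ?_, ?_⟩
  · exact Measure.AbsolutelyContinuous.add_left (h0.smul_left _) hαμ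
  · haveI : Nonempty {f : W → ℝ // Measurable f ∧ ∀ x, |f x| ≤ 1} :=
      ⟨⟨0, measurable_zero, by simp⟩⟩
    refine ciSup_le fun φ => ?_
    have hint : ∀ (m : Measure W) [IsFiniteMeasure m], Integrable φ.1 m := fun m _ =>
      Integrable.of_bound φ.2.1.aestronglyMeasurable 1
        (Filter.Eventually.of_forall fun x => by simpa using φ.2.2 x)
    have e1 : ∫ x, φ.1 x ∂(ν : Measure W) = ∫ x, φ.1 x ∂σ + ∫ x, φ.1 x ∂α := by
      rw [hdec]; exact integral_add_measure (hint _) (hint _)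
    have e2 : ∫ x, φ.1 x ∂r = σ.real univ * ∫ x, φ.1 x ∂(ν₀ : Measure W) + ∫ x, φ.1 x ∂α := by
      rw [integral_add_measure ((hint _).smul_measure (measure_ne_top _ _)) (hint _),
        integral_smul_measure]
      rfl
    have h1 := norm_integral_le_of_norm_le_const (μ := σ) (f := φ.1) (C := 1)
      (Filter.Eventually.of_forall fun x => by simpa using φ.2.2 x)
    have h2 := norm_integral_le_of_norm_le_const (μ := (ν₀ : Measure W)) (f := φ.1) (C := 1)
      (Filter.Eventually.of_forall fun x => by simpa using φ.2.2 x)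
    rw [Real.norm_eq_abs] at h1 h2
    have h3 : |σ.real univ * ∫ x, φ.1 x ∂(ν₀ : Measure W)| ≤ σ.real univ := by
      rw [abs_mul, abs_of_nonneg measureReal_nonneg]
      refine mul_le_of_le_one_right measureReal_nonneg ?_
      simpa using h2
    change |(∫ x, φ.1 x ∂(ν : Measure W)) - ∫ x, φ.1 x ∂r| ≤ _
    rw [e1, e2, add_sub_add_right_eq_sub]
    refine (abs_sub _ _).trans ?_
    linarith

section
variable {γbar lbar : ℝ}
    {γf : W → ProbabilityMeasure W → ℝ}
    {lf : W → W → ProbabilityMeasure W → ℝ}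
    {a : W → ProbabilityMeasure W → ProbabilityMeasure W}
    {b : W → W → ProbabilityMeasure W → ProbabilityMeasure (W × W)}

lemma aux_measA (hrates : RatesOK γbar lbar γf lf a b) (ν : ProbabilityMeasure W) :
    Measurable fun w => ENNReal.ofReal (γf w ν) • (a w ν : Measure W) := by
  obtain ⟨h1, -, -, -, -, -, h7, -⟩ := hrates
  refine Measure.measurable_of_measurable_coe _ fun S hS => ?_
  simp only [Measure.smul_apply, smul_eq_mul]
  exact (h1 ν).ennreal_ofReal.mul ((Measure.measurable_coe hS).comp (h7 ν))

lemma aux_measB₀ (hrates : RatesOK γbar lbar γf lf a b) (ν : ProbabilityMeasure W) :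
    Measurable fun p : W × W =>
      ENNReal.ofReal (lf p.1 p.2 ν) • (b p.1 p.2 ν : Measure (W × W)) := by
  obtain ⟨-, -, -, h1, -, -, -, h7⟩ := hrates
  refine Measure.measurable_of_measurable_coe _ fun S hS => ?_
  simp only [Measure.smul_apply, smul_eq_mul]
  exact (h1 ν).ennreal_ofReal.mul ((Measure.measurable_coe hS).comp (h7 ν))

lemma aux_measB₁ (hrates : RatesOK γbar lbar γf lf a b) (ν : ProbabilityMeasure W) (w₁ : W) :
    Measurable fun w₂ : W =>
      ENNReal.ofReal (lf w₁ w₂ ν) • (b w₁ w₂ ν : Measure (W × W)) :=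
  (aux_measB₀ hrates ν).comp measurable_prodMk_left

lemma aux_measB_val (hrates : RatesOK γbar lbar γf lf a b) (ν : ProbabilityMeasure W)
    {S : Set (W × W)} (hS : MeasurableSet S) :
    Measurable fun p : W × W => ENNReal.ofReal (lf p.1 p.2 ν) * (b p.1 p.2 ν : Measure (W × W)) S :=
  (Measure.measurable_coe hS).comp (aux_measB₀ hrates ν)

lemma aux_measB_val₁ (hrates : RatesOK γbar lbar γf lf a b) (ν : ProbabilityMeasure W)
    {S : Set (W × W)} (hS : MeasurableSet S) (w₁ : W) :
    Measurable fun w₂ : W => ENNReal.ofReal (lf w₁ w₂ ν) * (b w₁ w₂ ν : Measure (W × W)) S :=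
  (aux_measB_val hrates ν hS).comp measurable_prodMk_left

lemma aux_measB_val₂ (hrates : RatesOK γbar lbar γf lf a b) (ν : ProbabilityMeasure W)
    {S : Set (W × W)} (hS : MeasurableSet S) :
    Measurable fun w₁ : W => ∫⁻ w₂, ENNReal.ofReal (lf w₁ w₂ ν) *
      (b w₁ w₂ ν : Measure (W × W)) S ∂(ν : Measure W) :=
  (aux_measB_val hrates ν hS).lintegral_prod_right'

lemma aux_measB₂ (hrates : RatesOK γbar lbar γf lf a b) (ν : ProbabilityMeasure W) :
    Measurable fun w₁ : W => (ν : Measure W).bind fun w₂ =>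
      ENNReal.ofReal (lf w₁ w₂ ν) • (b w₁ w₂ ν : Measure (W × W)) := by
  refine Measure.measurable_of_measurable_coe _ fun S hS => ?_
  simp only [Measure.bind_apply hS (aux_measB₁ hrates ν _).aemeasurable]
  exact aux_measB_val₂ hrates ν hS

lemma aux_A_apply (hrates : RatesOK γbar lbar γf lf a b) (ν : ProbabilityMeasure W)
    {S : Set W} (hS : MeasurableSet S) :
    jumpMeasA γf a ν S = ∫⁻ w, ENNReal.ofReal (γf w ν) * (a w ν : Measure W) S ∂(ν : Measure W) := by
  unfold jumpMeasA
  rw [Measure.bind_apply hS (aux_measA hrates ν).aemeasurable]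
  simp only [Measure.smul_apply, smul_eq_mul]

lemma aux_B_apply (hrates : RatesOK γbar lbar γf lf a b) (ν : ProbabilityMeasure W)
    {S : Set (W × W)} (hS : MeasurableSet S) :
    jumpMeasB lf b ν S = ∫⁻ w₁, ∫⁻ w₂, ENNReal.ofReal (lf w₁ w₂ ν) *
      (b w₁ w₂ ν : Measure (W × W)) S ∂(ν : Measure W) ∂(ν : Measure W) := by
  unfold jumpMeasB
  rw [Measure.bind_apply hS (aux_measB₂ hrates ν).aemeasurable]
  simp only [Measure.bind_apply hS (aux_measB₁ hrates ν _).aemeasurable,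
    Measure.smul_apply, smul_eq_mul]

lemma aux_A_fin (hrates : RatesOK γbar lbar γf lf a b) (ν : ProbabilityMeasure W) :
    IsFiniteMeasure (jumpMeasA γf a ν) := ⟨by
  rw [aux_A_apply hrates ν MeasurableSet.univ]
  refine lt_of_le_of_lt (lintegral_mono (g := fun _ => ENNReal.ofReal γbar) fun w => ?_) ?_
  · simpa using ENNReal.ofReal_le_ofReal (hrates.2.1 w ν).2
  · simp⟩

lemma aux_B_fin (hrates : RatesOK γbar lbar γf lf a b) (ν : ProbabilityMeasure W) :
    IsFiniteMeasure (jumpMeasB lf b ν) := ⟨by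
  rw [aux_B_apply hrates ν MeasurableSet.univ]
  refine lt_of_le_of_lt (lintegral_mono (g := fun _ => ∫⁻ _, ENNReal.ofReal lbar ∂(ν : Measure W))
    fun w => lintegral_mono fun w₂ => ?_) ?_
  · simpa using ENNReal.ofReal_le_ofReal (hrates.2.2.2.2.1 w w₂ ν).2
  · simp⟩

lemma aux_boundA (hrates : RatesOK γbar lbar γf lf a b) (ν : ProbabilityMeasure W)
    {N : Set W} (hN : MeasurableSet N) :
    ‖∫ w, γf w ν * ∫ w', (N.indicator (1 : W → ℝ) w' - N.indicator (1 : W → ℝ) w)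
        ∂(a w ν : Measure W) ∂(ν : Measure W)‖ₑ
      ≤ jumpMeasA γf a ν N + ENNReal.ofReal γbar * (ν : Measure W) N := by
  refine (enorm_integral_le_lintegral_enorm _).trans ?_
  rw [aux_A_apply hrates ν hN, ← lintegral_indicator_one hN, ← lintegral_const_mul _
    (measurable_one.indicator hN), ← lintegral_add_right _
    ((measurable_one.indicator hN).const_mul _)]
  refine lintegral_mono fun w => ?_
  have hg := hrates.2.1 w ν
  rw [enorm_mul]
  have e1 : ‖γf w ν‖ₑ = ENNReal.ofReal (γf w ν) := Real.enorm_of_nonneg hg.1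
  have e2 : ‖∫ w', (N.indicator (1 : W → ℝ) w' - N.indicator (1 : W → ℝ) w)
        ∂(a w ν : Measure W)‖ₑ ≤ (a w ν : Measure W) N + N.indicator 1 w := by
    refine (enorm_integral_le_lintegral_enorm _).trans ?_
    calc _ ≤ ∫⁻ w', (N.indicator (1 : W → ENNReal) w' + N.indicator (1 : W → ENNReal) w)
            ∂(a w ν : Measure W) := lintegral_mono fun w' => by
              refine (enorm_sub_le).trans (add_le_add ?_ ?_)
              · by_cases h : w' ∈ N <;> simp [h]
              · by_cases h : w ∈ N <;> simp [h]
      _ = _ := by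
        rw [lintegral_add_right _ measurable_const, lintegral_indicator_one hN]; simp
  rw [e1]
  calc _ ≤ ENNReal.ofReal (γf w ν) * ((a w ν : Measure W) N + N.indicator 1 w) := by gcongr
    _ ≤ _ := by
      rw [mul_add]
      gcongr
      exact hg.2

lemma aux_boundB (hrates : RatesOK γbar lbar γf lf a b) (ν : ProbabilityMeasure W)
    {N : Set W} (hN : MeasurableSet N) :
    ‖∫ w₁, ∫ w₂, lf w₁ w₂ ν * ∫ p : W × W, (N.indicator (1 : W → ℝ) p.1
        + N.indicator (1 : W → ℝ) p.2 - N.indicator (1 : W → ℝ) w₁ - N.indicator (1 : W → ℝ) w₂)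
        ∂(b w₁ w₂ ν : Measure (W × W)) ∂(ν : Measure W) ∂(ν : Measure W)‖ₑ
      ≤ jumpMeasB lf b ν (N ×ˢ univ) + jumpMeasB lf b ν (univ ×ˢ N)
        + ENNReal.ofReal lbar * (ν : Measure W) N + ENNReal.ofReal lbar * (ν : Measure W) N := by
  have hN1 : MeasurableSet (N ×ˢ (univ : Set W)) := hN.prod MeasurableSet.univ
  have hN2 : MeasurableSet ((univ : Set W) ×ˢ N) := MeasurableSet.univ.prod hN
  have hI : Measurable (N.indicator (1 : W → ENNReal)) := measurable_one.indicator hN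
  have key : ∀ w₁ w₂, ‖lf w₁ w₂ ν * ∫ p : W × W, (N.indicator (1 : W → ℝ) p.1
        + N.indicator (1 : W → ℝ) p.2 - N.indicator (1 : W → ℝ) w₁ - N.indicator (1 : W → ℝ) w₂)
        ∂(b w₁ w₂ ν : Measure (W × W))‖ₑ ≤
      ENNReal.ofReal (lf w₁ w₂ ν) * (b w₁ w₂ ν : Measure (W × W)) (N ×ˢ univ)
      + ENNReal.ofReal (lf w₁ w₂ ν) * (b w₁ w₂ ν : Measure (W × W)) (univ ×ˢ N)
      + ENNReal.ofReal lbar * N.indicator 1 w₁ + ENNReal.ofReal lbar * N.indicator 1 w₂ := by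
    intro w₁ w₂
    have hg := hrates.2.2.2.2.1 w₁ w₂ ν
    rw [enorm_mul]
    have e1 : ‖lf w₁ w₂ ν‖ₑ = ENNReal.ofReal (lf w₁ w₂ ν) := Real.enorm_of_nonneg hg.1
    have hi : ∀ w, ‖N.indicator (1 : W → ℝ) w‖ₑ = N.indicator (1 : W → ENNReal) w := fun w => by
      by_cases h : w ∈ N <;> simp [h]
    have e2 : ‖∫ p : W × W, (N.indicator (1 : W → ℝ) p.1
        + N.indicator (1 : W → ℝ) p.2 - N.indicator (1 : W → ℝ) w₁ - N.indicator (1 : W → ℝ) w₂)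
        ∂(b w₁ w₂ ν : Measure (W × W))‖ₑ ≤ (b w₁ w₂ ν : Measure (W × W)) (N ×ˢ univ)
        + (b w₁ w₂ ν : Measure (W × W)) (univ ×ˢ N) + N.indicator 1 w₁ + N.indicator 1 w₂ := by
      refine (enorm_integral_le_lintegral_enorm _).trans ?_
      calc _ ≤ ∫⁻ p : W × W, ((N ×ˢ (univ : Set W)).indicator (1 : W × W → ENNReal) p
              + ((univ : Set W) ×ˢ N).indicator (1 : W × W → ENNReal) p
              + N.indicator (1 : W → ENNReal) w₁ + N.indicator (1 : W → ENNReal) w₂)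
              ∂(b w₁ w₂ ν : Measure (W × W)) := lintegral_mono fun p => by
                refine (enorm_sub_le).trans (add_le_add ((enorm_sub_le).trans
                  (add_le_add ((enorm_add_le _ _).trans (add_le_add ?_ ?_)) (hi w₁).le)) (hi w₂).le)
                · rw [hi]; by_cases h : p.1 ∈ N <;> simp [h, indicator]
                · rw [hi]; by_cases h : p.2 ∈ N <;> simp [h, indicator]
        _ = _ := by
          rw [lintegral_add_right _ measurable_const, lintegral_add_right _ measurable_const,
            lintegral_add_right _ (measurable_one.indicator hN2), lintegral_indicator_one hN1,
            lintegral_indicator_one hN2]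
          simp
    rw [e1]
    refine (mul_le_mul_right e2 _).trans ?_
    rw [mul_add, mul_add, mul_add]
    gcongr
    · exact hg.2
    · exact hg.2
  calc _ ≤ ∫⁻ w₁, ∫⁻ w₂, (ENNReal.ofReal (lf w₁ w₂ ν) * (b w₁ w₂ ν : Measure (W × W)) (N ×ˢ univ)
      + ENNReal.ofReal (lf w₁ w₂ ν) * (b w₁ w₂ ν : Measure (W × W)) (univ ×ˢ N)
      + ENNReal.ofReal lbar * N.indicator 1 w₁ + ENNReal.ofReal lbar * N.indicator 1 w₂)
        ∂(ν : Measure W) ∂(ν : Measure W) := by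
        refine (enorm_integral_le_lintegral_enorm _).trans (lintegral_mono fun w₁ => ?_)
        exact (enorm_integral_le_lintegral_enorm _).trans (lintegral_mono fun w₂ => key w₁ w₂)
    _ = ∫⁻ w₁, (∫⁻ w₂, ENNReal.ofReal (lf w₁ w₂ ν) * (b w₁ w₂ ν : Measure (W × W)) (N ×ˢ univ)
          ∂(ν : Measure W)
      + ∫⁻ w₂, ENNReal.ofReal (lf w₁ w₂ ν) * (b w₁ w₂ ν : Measure (W × W)) (univ ×ˢ N)
          ∂(ν : Measure W)
      + ENNReal.ofReal lbar * N.indicator 1 w₁ + ENNReal.ofReal lbar * (ν : Measure W) N)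
        ∂(ν : Measure W) := by
        refine lintegral_congr fun w₁ => ?_
        rw [lintegral_add_right _ (hI.const_mul _), lintegral_add_right _ measurable_const,
          lintegral_add_right _ (aux_measB_val₁ hrates ν hN2 w₁), lintegral_const_mul _ hI,
          lintegral_indicator_one hN]
        simp
    _ = _ := by
        rw [lintegral_add_right _ measurable_const, lintegral_add_right _ (hI.const_mul _),
          lintegral_add_right _ (aux_measB_val₂ hrates ν hN2), lintegral_const_mul _ hI,
          lintegral_indicator_one hN, aux_B_apply hrates ν hN1, aux_B_apply hrates ν hN2]
        simp

end

/-- **Preservation of absolute continuity** (Corollary 3.2): suppose the rates are bounded and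
measurable, Assumption (A3) holds, and `μ` is a σ-finite Borel measure on `W` such that for
every probability measure `ρ ≪ μ` the measure `∫ γ(w,ρ) a(w,ρ,·) ρ(dw)` is `≪ μ` and the
measure `∫∫ λ(w₁,w₂,ρ) b(w₁,w₂,ρ,·) ρ(dw₂) ρ(dw₁)` is `≪ μ ⊗ μ`.  If `ν` is a weakly
continuous solution of (S) on `[0,T]` with `ν₀ ≪ μ`, then `ν_t ≪ μ` for every `t ∈ [0,T]`. -/
theorem absolute_continuity_preserved
    (T : ℝ) (hT : 0 < T) (γbar lbar : ℝ)
    (γf : W → ProbabilityMeasure W → ℝ)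
    (lf : W → W → ProbabilityMeasure W → ℝ)
    (a : W → ProbabilityMeasure W → ProbabilityMeasure W)
    (b : W → W → ProbabilityMeasure W → ProbabilityMeasure (W × W))
    (hrates : RatesOK γbar lbar γf lf a b)
    (hA3 : AssumptionA3 γf lf a b)
    (μ : Measure W) (hμ : SigmaFinite μ)
    (hac₁ : ∀ ρ : ProbabilityMeasure W, (ρ : Measure W) ≪ μ →
      jumpMeasA γf a ρ ≪ μ)
    (hac₂ : ∀ ρ : ProbabilityMeasure W, (ρ : Measure W) ≪ μ →
      jumpMeasB lf b ρ ≪ μ.prod μ)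
    (ν : ℝ → ProbabilityMeasure W)
    (hc : ContinuousOn ν (Icc 0 T))
    (hs : SolvesS T γf lf a b ν)
    (h0 : (ν 0 : Measure W) ≪ μ) :
    ∀ t ∈ Icc (0 : ℝ) T, (ν t : Measure W) ≪ μ := by
  obtain ⟨-, -, ⟨Ca, hCa, hA⟩, ⟨Cb, hCb, hB⟩⟩ := hA3
  obtain ⟨w0⟩ : Nonempty W := nonempty_of_isProbabilityMeasure (ν 0 : Measure W)
  have hγ : 0 ≤ γbar := (hrates.2.1 w0 (ν 0)).1.trans (hrates.2.1 w0 (ν 0)).2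
  have hl : 0 ≤ lbar :=
    (hrates.2.2.2.2.1 w0 w0 (ν 0)).1.trans (hrates.2.2.2.2.1 w0 w0 (ν 0)).2
  haveI : ∀ ρ, IsFiniteMeasure (jumpMeasA γf a ρ) := aux_A_fin hrates
  haveI : ∀ ρ, IsFiniteMeasure (jumpMeasB lf b ρ) := aux_B_fin hrates
  set K₁ : ℝ := 2 * Ca + γbar with hK₁
  set K₂ : ℝ := 4 * Cb + 2 * lbar with hK₂
  set K : ℝ := K₁ + K₂ with hK
  have main : ∀ n : ℕ, ∀ t ∈ Icc (0 : ℝ) T, ∀ N, MeasurableSet N → μ N = 0 →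
      (ν t : Measure W).real N ≤ K ^ n * (t ^ n / (n.factorial : ℝ)) := by
    intro n
    induction n with
    | zero => intro t ht N hN h; simpa using measureReal_le_one
    | succ n ih =>
      intro t ht N hN h
      have hn0 : (ν 0 : Measure W).real N = 0 := by simp [Measure.real, h0 h]
      have hsol := hs (N.indicator 1) (measurable_one.indicator hN)
        ⟨1, fun x => by by_cases hx : x ∈ N <;> simp [hx]⟩ t ht
      rw [integral_indicator_one hN, integral_indicator_one hN, hn0, zero_add] at hsol
      have hbd : ∀ s ∈ Icc (0 : ℝ) T, 
          (jumpMeasA γf a (ν s)).real N ≤ Ca * (2 * (K ^ n * (s ^ n / (n.factorial : ℝ)))) ∧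
          (jumpMeasB lf b (ν s)).real (N ×ˢ univ)
            ≤ Cb * (2 * (K ^ n * (s ^ n / (n.factorial : ℝ)))) ∧
          (jumpMeasB lf b (ν s)).real (univ ×ˢ N)
            ≤ Cb * (2 * (K ^ n * (s ^ n / (n.factorial : ℝ)))) := by
        intro s hs'
        obtain ⟨ρ, hρ, htv⟩ := aux_approx μ (ν s) (ν 0) h0 _ (ih s hs')
        refine ⟨?_, ?_, ?_⟩
        · exact (aux_tv_set _ (jumpMeasA γf a ρ) N hN (hac₁ ρ hρ h)).trans
            ((hA _ _).trans (by gcongr))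
        · exact (aux_tv_set _ (jumpMeasB lf b ρ) _ (hN.prod MeasurableSet.univ)
            (hac₂ ρ hρ (by rw [Measure.prod_prod, h, zero_mul]))).trans
            ((hB _ _).trans (by gcongr))
        · exact (aux_tv_set _ (jumpMeasB lf b ρ) _ (MeasurableSet.univ.prod hN)
            (hac₂ ρ hρ (by rw [Measure.prod_prod, h, mul_zero]))).trans
            ((hB _ _).trans (by gcongr))
      have hcont : ∀ c : ℝ, IntervalIntegrable
          (fun s : ℝ => c * (K ^ n * (s ^ n / (n.factorial : ℝ)))) volume 0 t := fun c =>
        Continuous.intervalIntegrable (by fun_prop) _ _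
      have hval : ∀ c : ℝ, ∫ s in (0 : ℝ)..t, c * (K ^ n * (s ^ n / (n.factorial : ℝ)))
          = c * (K ^ n * (t ^ (n + 1) / ((n + 1).factorial : ℝ))) := by
        intro c
        rw [intervalIntegral.integral_const_mul, intervalIntegral.integral_const_mul,
          intervalIntegral.integral_div, integral_pow, Nat.factorial_succ]
        push_cast
        have : (n.factorial : ℝ) ≠ 0 := by positivity
        field_simp
        simp
      have h1 := intervalIntegral.norm_integral_le_of_norm_le (μ := volume) (a := 0) (b := t)
        (f := fun s => ∫ w, γf w (ν s) * ∫ w', (N.indicator (1 : W → ℝ) w' -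
          N.indicator (1 : W → ℝ) w) ∂(a w (ν s) : Measure W) ∂(ν s : Measure W))
        (g := fun s => K₁ * (K ^ n * (s ^ n / (n.factorial : ℝ)))) ht.1
        (Filter.Eventually.of_forall fun s hst => by
          have hsI : s ∈ Icc (0 : ℝ) T := ⟨hst.1.le, hst.2.trans ht.2⟩
          have hb := ENNReal.toReal_mono (by finiteness) (aux_boundA hrates (ν s) hN)
          rw [toReal_enorm, ENNReal.toReal_add (by finiteness) (by finiteness),
            ENNReal.toReal_mul, ENNReal.toReal_ofReal hγ] at hb
          have i1 := mul_le_mul_of_nonneg_left (ih s hsI N hN h) hγ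
          have i2 := (hbd s hsI).1
          simp only [Measure.real] at i1 i2
          refine hb.trans ((add_le_add i2 i1).trans (le_of_eq ?_))
          rw [hK₁]; ring) (hcont _)
      have h2 := intervalIntegral.norm_integral_le_of_norm_le (μ := volume) (a := 0) (b := t)
        (f := fun s => ∫ w₁, ∫ w₂, lf w₁ w₂ (ν s) * ∫ p : W × W, (N.indicator (1 : W → ℝ) p.1
          + N.indicator (1 : W → ℝ) p.2 - N.indicator (1 : W → ℝ) w₁
          - N.indicator (1 : W → ℝ) w₂) ∂(b w₁ w₂ (ν s) : Measure (W × W))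
            ∂(ν s : Measure W) ∂(ν s : Measure W))
        (g := fun s => K₂ * (K ^ n * (s ^ n / (n.factorial : ℝ)))) ht.1
        (Filter.Eventually.of_forall fun s hst => by
          have hsI : s ∈ Icc (0 : ℝ) T := ⟨hst.1.le, hst.2.trans ht.2⟩
          have hb := ENNReal.toReal_mono (by finiteness) (aux_boundB hrates (ν s) hN)
          rw [toReal_enorm, ENNReal.toReal_add (by finiteness) (by finiteness),
            ENNReal.toReal_add (by finiteness) (by finiteness),
            ENNReal.toReal_add (by finiteness) (by finiteness),
            ENNReal.toReal_mul, ENNReal.toReal_ofReal hl] at hb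
          have i1 := mul_le_mul_of_nonneg_left (ih s hsI N hN h) hl
          have i2 := (hbd s hsI).2.1
          have i3 := (hbd s hsI).2.2
          simp only [Measure.real] at i1 i2 i3
          refine hb.trans ((add_le_add (add_le_add (add_le_add i2 i3) i1) i1).trans (le_of_eq ?_))
          rw [hK₂]; ring) (hcont _)
      rw [hval] at h1 h2
      rw [hsol]
      refine (add_le_add ((le_abs_self _).trans h1) ((le_abs_self _).trans h2)).trans
        (le_of_eq ?_)
      rw [pow_succ K n, hK]; ring
  intro t ht
  refine Measure.AbsolutelyContinuous.mk fun N hN h => ?_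
  have hlim : Filter.Tendsto (fun n : ℕ => K ^ n * (t ^ n / (n.factorial : ℝ))) Filter.atTop
      (nhds 0) := by
    have := FloorSemiring.tendsto_pow_div_factorial_atTop (K * t)
    refine this.congr fun n => ?_
    rw [mul_pow, mul_div_assoc]
  have hle : (ν t : Measure W).real N ≤ 0 :=
    ge_of_tendsto' hlim fun n => main n t ht N hN h
  exact (measureReal_eq_zero_iff (measure_ne_top _ _)).1 (le_antisymm hle measureReal_nonneg)

end
end

section
/- Uniform boundedness of the drift operator on ℓ^{∞,2D}(ℤ^d) (verification of Assumption (C3.i) in the proof of Theorem 4.6): Let d ≥ 1, D = ⌊d/2⌋ + 1, and let {Γ(x,z,·)}_{x,z∈ℤ^d} be finite measures on ℤ^d with Σ_y Γ(x,z,{y}) ≤ γ̄ and satisfying Σ_{y∈ℤ^d} (1+‖y‖^{2D}) Γ(x,z,{y}) ≤ C₀ (1 + ‖x‖^{2D} + ‖z‖^{2D}) for all x, z ∈ ℤ^d. For probability measures μ₁, μ₂ on ℤ^d with Σ_x (1+‖x‖^{2D}) μ_i({x}) ≤ K (i = 1,2), define J_{μ₁,μ₂}φ(z) = Σ_{x,y∈ℤ^d}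 (φ(y)−φ(x)) Γ(x,z,{y}) μ₁({x}) + Σ_{x,y∈ℤ^d} (φ(y)−φ(z)) Γ(z,x,{y}) μ₂({x}). Then there is a constant C, depending only on γ̄, C₀, K and D, such that for every φ with ‖φ‖_{∞,2D} < ∞ one has ‖J_{μ₁,μ₂}φ‖_{∞,2D} ≤ C ‖φ‖_{∞,2D}. -/
open Set

noncomputable section

/-- The Euclidean norm of a point of `ℤ^d`. -/
noncomputable def znorm {d : ℕ} (x : Fin d → ℤ) : ℝ :=
  Real.sqrt (∑ i, ((x i : ℝ)) ^ 2)

/-- The drift operator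
`J_{μ₁,μ₂}φ(z) = Σ_{x,y} (φ(y)−φ(x)) Γ(x,z,{y}) μ₁({x}) + Σ_{x,y} (φ(y)−φ(z)) Γ(z,x,{y}) μ₂({x})`. -/
noncomputable def Jop {d : ℕ} (Γ : (Fin d → ℤ) → (Fin d → ℤ) → (Fin d → ℤ) → ℝ)
    (μ₁ μ₂ : (Fin d → ℤ) → ℝ) (φ : (Fin d → ℤ) → ℝ) (z : Fin d → ℤ) : ℝ :=
  (∑' x : Fin d → ℤ, ∑' y : Fin d → ℤ, (φ y - φ x) * Γ x z y * μ₁ x)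
    + ∑' x : Fin d → ℤ, ∑' y : Fin d → ℤ, (φ y - φ z) * Γ z x y * μ₂ x

theorem inner_bd {ι : Type*} (w φ g : ι → ℝ) (M γ B m : ℝ) (a : ι)
    (hw : ∀ x, 1 ≤ w x) (hM : 0 ≤ M) (hφ : ∀ x, |φ x| ≤ M * w x) (hg : ∀ y, 0 ≤ g y)
    (hs : Summable fun y => w y * g y) (h1 : ∑' y, g y ≤ γ) (h2 : ∑' y, w y * g y ≤ B)
    (hm : 0 ≤ m) :
    ‖∑' y, (φ y - φ a) * g y * m‖ ≤ M * (B + γ * w a) * m := by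
  have hsg : Summable g := Summable.of_nonneg_of_le hg
    (fun y => by nlinarith [hw y, hg y]) hs
  have hsum : HasSum (fun y => M * (w y * g y + g y * w a) * m)
      (M * ((∑' y, w y * g y) + (∑' y, g y) * w a) * m) :=
    ((hs.hasSum.add (hsg.hasSum.mul_right (w a))).mul_left M).mul_right m
  refine (tsum_of_norm_bounded hsum ?_).trans ?_
  · intro y
    rw [Real.norm_eq_abs, abs_mul, abs_mul, abs_of_nonneg (hg y), abs_of_nonneg hm]
    refine mul_le_mul_of_nonneg_right ?_ hm
    have h := abs_sub (φ y) (φ a)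
    have h' : |φ y - φ a| ≤ M * w y + M * w a := by linarith [hφ y, hφ a]
    calc |φ y - φ a| * g y ≤ (M * w y + M * w a) * g y :=
          mul_le_mul_of_nonneg_right h' (hg y)
      _ = _ := by ring
  · have := hw a
    have h0 : 0 ≤ w a := by linarith
    gcongr

/-- **Uniform boundedness of the drift operator on `ℓ^{∞,2D}(ℤ^d)`** (verification of
Assumption (C3.i) in the proof of Theorem 4.6): with `D = ⌊d/2⌋ + 1`, if the jump kernels
`Γ(x,z,·)` have total mass at most `γbar` and `2D`-moments bounded by
`C₀(1+‖x‖^{2D}+‖z‖^{2D})`, and `μ₁, μ₂` are probability measures on `ℤ^d` with `2D`-moments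
at most `K`, then `‖J_{μ₁,μ₂}φ‖_{∞,2D} ≤ C ‖φ‖_{∞,2D}` for a constant `C` depending only on
`γbar`, `C₀`, `K` and `D`. -/
theorem drift_operator_bounded
    (d : ℕ) (hd : 1 ≤ d) (γbar C₀ K : ℝ) (hγ : 0 ≤ γbar) (hC₀ : 0 ≤ C₀) (hK : 0 ≤ K) :
    ∃ C : ℝ, 0 < C ∧
      ∀ Γ : (Fin d → ℤ) → (Fin d → ℤ) → (Fin d → ℤ) → ℝ,
        (∀ x z y, 0 ≤ Γ x z y) →
        (∀ x z, Summable (fun y : Fin d → ℤ =>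
          (1 + znorm y ^ (2 * (d / 2 + 1))) * Γ x z y)) →
        (∀ x z, (∑' y : Fin d → ℤ, Γ x z y) ≤ γbar) →
        (∀ x z, (∑' y : Fin d → ℤ, (1 + znorm y ^ (2 * (d / 2 + 1))) * Γ x z y)
          ≤ C₀ * (1 + znorm x ^ (2 * (d / 2 + 1)) + znorm z ^ (2 * (d / 2 + 1)))) →
        ∀ μ₁ μ₂ : (Fin d → ℤ) → ℝ,
          (∀ x, 0 ≤ μ₁ x) → HasSum μ₁ 1 →
          (∀ x, 0 ≤ μ₂ x) → HasSum μ₂ 1 →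
          Summable (fun x : Fin d → ℤ => (1 + znorm x ^ (2 * (d / 2 + 1))) * μ₁ x) →
          Summable (fun x : Fin d → ℤ => (1 + znorm x ^ (2 * (d / 2 + 1))) * μ₂ x) →
          (∑' x : Fin d → ℤ, (1 + znorm x ^ (2 * (d / 2 + 1))) * μ₁ x) ≤ K →
          (∑' x : Fin d → ℤ, (1 + znorm x ^ (2 * (d / 2 + 1))) * μ₂ x) ≤ K →
          ∀ φ : (Fin d → ℤ) → ℝ,
            BddAbove (range fun x : Fin d → ℤ =>
              |φ x| / (1 + znorm x ^ (2 * (d / 2 + 1)))) →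
            ∀ z : Fin d → ℤ,
              |Jop Γ μ₁ μ₂ φ z| / (1 + znorm z ^ (2 * (d / 2 + 1)))
                ≤ C * ⨆ x : Fin d → ℤ, |φ x| / (1 + znorm x ^ (2 * (d / 2 + 1))) := by
  refine ⟨2 * C₀ * K + 2 * C₀ + γbar * K + γbar + 1, by positivity, ?_⟩
  intro Γ hΓ hΓs hΓγ hΓC μ₁ μ₂ hμ₁ hs₁ hμ₂ hs₂ hw₁ hw₂ hK₁ hK₂ φ hφ z
  set w : (Fin d → ℤ) → ℝ := fun x => 1 + znorm x ^ (2 * (d / 2 + 1)) with hw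
  set M : ℝ := ⨆ x : Fin d → ℤ, |φ x| / (1 + znorm x ^ (2 * (d / 2 + 1))) with hMdef
  have hw1 : ∀ x, 1 ≤ w x := fun x => by
    have : 0 ≤ znorm x ^ (2 * (d / 2 + 1)) := pow_nonneg (Real.sqrt_nonneg _) _
    simp only [hw]; linarith
  have hw0 : ∀ x, 0 < w x := fun x => by linarith [hw1 x]
  have hφM : ∀ x, |φ x| ≤ M * w x := fun x =>
    (div_le_iff₀ (hw0 x)).1 (le_ciSup hφ x)
  have hM : 0 ≤ M := Real.iSup_nonneg fun x => div_nonneg (abs_nonneg _) (hw0 x).le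
  have hB : ∀ x z, ∑' y, w y * Γ x z y ≤ C₀ * (w x + w z) := fun x z =>
    (hΓC x z).trans (mul_le_mul_of_nonneg_left (by simp only [hw]; linarith) hC₀)
  have b1 : |∑' x, ∑' y, (φ y - φ x) * Γ x z y * μ₁ x| ≤
      M * ((C₀ + γbar) * (∑' x, w x * μ₁ x) + C₀ * w z * 1) := by
    rw [← Real.norm_eq_abs]
    refine tsum_of_norm_bounded
      (((hw₁.hasSum.mul_left (C₀ + γbar)).add (hs₁.mul_left (C₀ * w z))).mul_left M) ?_
    intro x
    refine (inner_bd w φ (Γ x z) M γbar _ (μ₁ x) x hw1 hM hφM (hΓ x z) (hΓs x z) (hΓγ x z)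
      (hB x z) (hμ₁ x)).trans (le_of_eq ?_)
    simp only [hw]; ring
  have b2 : |∑' x, ∑' y, (φ y - φ z) * Γ z x y * μ₂ x| ≤
      M * (C₀ * (∑' x, w x * μ₂ x) + (C₀ + γbar) * w z * 1) := by
    rw [← Real.norm_eq_abs]
    refine tsum_of_norm_bounded
      (((hw₂.hasSum.mul_left C₀).add (hs₂.mul_left ((C₀ + γbar) * w z))).mul_left M) ?_
    intro x
    refine (inner_bd w φ (Γ z x) M γbar _ (μ₂ x) z hw1 hM hφM (hΓ z x) (hΓs z x) (hΓγ z x)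
      (hB z x) (hμ₂ x)).trans (le_of_eq ?_)
    simp only [hw]; ring
  rw [div_le_iff₀ (hw0 z)]
  change _ ≤ _ * w z
  have c1 : (C₀ + γbar) * (∑' x, w x * μ₁ x) ≤ (C₀ + γbar) * K * w z :=
    (mul_le_mul_of_nonneg_left hK₁ (by positivity)).trans
      (le_mul_of_one_le_right (by positivity) (hw1 z))
  have c2 : C₀ * (∑' x, w x * μ₂ x) ≤ C₀ * K * w z :=
    (mul_le_mul_of_nonneg_left hK₂ (by positivity)).trans
      (le_mul_of_one_le_right (by positivity) (hw1 z))
  have c3 := mul_le_mul_of_nonneg_left (add_le_add c1 c2) hM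
  have c4 : 0 ≤ M * w z := mul_nonneg hM (hw0 z).le
  refine (abs_add_le _ _).trans ((add_le_add b1 b2).trans ?_)
  nlinarith [c3, c4]

end
end
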